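/- arXiv:2312.16795 — 2 statements merged into one kernel-verified Lean document; each statement's English description precedes it below -/
import Mathlib

section
/- For integers n ≥ 3 and 1 ≤ c ≤ ⌊(n-1)/2⌋, one has n < q(F_{n,c}) ≤ q(F_n), and the right-hand equality holds if and only if c = ⌊(n-1)/2⌋ (i.e., F_{n,c} ≅ F_n). -/
open SimpleGraph Finset

/-- The signless Laplacian matrix `Q(G) = D(G) + A(G)` of a finite simple graph. -/
noncomputable def signlessLapMatrix {V : Type*} [Fintype V] [DecidableEq V]
    (G : SimpleGraph V) : Matrix V V ℝ :=
  letI := Classical.decRel G.Adj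
  Matrix.diagonal (fun v => (G.degree v : ℝ)) + G.adjMatrix ℝ

/-- The signless Laplacian spectral radius `q(G)`: the largest eigenvalue of `Q(G)`. -/
noncomputable def qSpecRad {V : Type*} [Fintype V] [DecidableEq V]
    (G : SimpleGraph V) : ℝ :=
  sSup (spectrum ℝ (signlessLapMatrix G))

/-- The largest Laplacian eigenvalue `μ(G)`. -/
noncomputable def muSpecRad {V : Type*} [Fintype V] [DecidableEq V]
    (G : SimpleGraph V) : ℝ :=
  letI := Classical.decRel G.Adj
  sSup (spectrum ℝ (G.lapMatrix ℝ))

/-- `G` has a chorded cycle: a cycle together with an edge of `G` joining two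
vertices of the cycle which is not an edge of the cycle. -/
def HasChordedCycle {V : Type*} (G : SimpleGraph V) : Prop :=
  ∃ (v : V) (C : G.Walk v v), C.IsCycle ∧
    ∃ a b : V, a ∈ C.support ∧ b ∈ C.support ∧ G.Adj a b ∧ s(a, b) ∉ C.edges

/-- `F_{n,c}`: the star `K_{1,n-1}` with center `0` together with `c` pairwise
nonadjacent edges among the leaves, namely the edges `(2k+1, 2k+2)` for `k < c`. -/
def Fgraph (n c : ℕ) : SimpleGraph (Fin n) :=
  SimpleGraph.fromRel (fun i j =>
    i.val = 0 ∨ (j.val = i.val + 1 ∧ j.val % 2 = 0 ∧ j.val ≤ 2 * c))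

/-- `H^{(n)}_{a₁,a₂,b₁,b₂}` (for `n = 3 + a₁ + 2a₂ + b₁ + 2b₂`): a triangle `u v w`
(vertices `0, 1, 2`), with `a₁` pendant edges and `a₂` triangles attached at `u = 0`,
and `b₁` pendant edges and `b₂` triangles attached at `v = 1`. -/
def Hgraph (n a₁ a₂ b₁ b₂ : ℕ) : SimpleGraph (Fin n) :=
  SimpleGraph.fromRel (fun x y =>
    (x.val = 0 ∧ y.val = 1) ∨ (x.val = 0 ∧ y.val = 2) ∨ (x.val = 1 ∧ y.val = 2) ∨
    (x.val = 0 ∧ 3 ≤ y.val ∧ y.val < 3 + a₁ + 2 * a₂) ∨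
    (3 + a₁ ≤ x.val ∧ y.val = x.val + 1 ∧ (x.val - (3 + a₁)) % 2 = 0 ∧
      y.val < 3 + a₁ + 2 * a₂) ∨
    (x.val = 1 ∧ 3 + a₁ + 2 * a₂ ≤ y.val ∧ y.val < 3 + a₁ + 2 * a₂ + b₁ + 2 * b₂) ∨
    (3 + a₁ + 2 * a₂ + b₁ ≤ x.val ∧ y.val = x.val + 1 ∧
      (x.val - (3 + a₁ + 2 * a₂ + b₁)) % 2 = 0 ∧
      y.val < 3 + a₁ + 2 * a₂ + b₁ + 2 * b₂))

/-- `G` is a regular graph. -/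
def IsRegularGraph {V : Type*} [Fintype V] (G : SimpleGraph V) : Prop :=
  letI := Classical.decRel G.Adj
  ∃ d, G.IsRegularOfDegree d

/-- `G` is a semi-regular bipartite graph: there is a bipartition such that every edge
crosses it and vertices in the same part all have the same degree. -/
def IsSemiregularBipartite {V : Type*} [Fintype V] (G : SimpleGraph V) : Prop :=
  letI := Classical.decRel G.Adj
  ∃ (s : Set V) (d₁ d₂ : ℕ),
    (∀ ⦃a b⦄, G.Adj a b → (a ∈ s ↔ b ∉ s)) ∧
    (∀ a ∈ s, G.degree a = d₁) ∧ (∀ a ∉ s, G.degree a = d₂)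

lemma mem_spectrum_iff_exists_mulVec {V : Type*} [Fintype V] [DecidableEq V]
    (A : Matrix V V ℝ) (μ : ℝ) :
    μ ∈ spectrum ℝ A ↔ ∃ v : V → ℝ, v ≠ 0 ∧ A.mulVec v = μ • v := by
  rw [← Matrix.spectrum_toLin', ← Module.End.hasEigenvalue_iff_mem_spectrum]
  constructor
  · intro h
    obtain ⟨v, hv⟩ := h.exists_hasEigenvector
    exact ⟨v, hv.2, by simpa using hv.apply_eq_smul⟩
  · rintro ⟨v, hv, h⟩
    refine Module.End.hasEigenvalue_of_hasEigenvector (x := v) ⟨?_, hv⟩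
    rw [Module.End.mem_eigenspace_iff]
    simpa using h

/-- A nonnegative matrix with a positive eigenvector has no real eigenvalue larger than the
eigenvalue of that eigenvector. -/
lemma sSup_spectrum_eq_of_pos_eigenvector {V : Type*} [Fintype V] [DecidableEq V] [Nonempty V]
    (A : Matrix V V ℝ) (hA : ∀ i j, 0 ≤ A i j) (w : V → ℝ) (hw : ∀ i, 0 < w i) (r : ℝ)
    (h : A.mulVec w = r • w) : sSup (spectrum ℝ A) = r := by
  refine IsGreatest.csSup_eq ⟨?_, ?_⟩
  · rw [mem_spectrum_iff_exists_mulVec]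
    refine ⟨w, fun h0 => ?_, h⟩
    obtain ⟨i⟩ := ‹Nonempty V›
    exact (hw i).ne' (congrFun h0 i)
  · intro μ hμ
    obtain ⟨v, hv0, hv⟩ := (mem_spectrum_iff_exists_mulVec A μ).1 hμ
    obtain ⟨i, hi⟩ := Finite.exists_max (fun i => |v i| / w i)
    set t := |v i| / w i with ht
    have hle : ∀ j, |v j| ≤ t * w j := fun j => (div_le_iff₀ (hw j)).1 (hi j)
    have hti : |v i| = t * w i := (div_mul_cancel₀ _ (hw i).ne').symm
    have htpos : 0 < t := by
      obtain ⟨j, hj⟩ := Function.ne_iff.1 hv0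
      exact lt_of_lt_of_le (div_pos (abs_pos.2 hj) (hw j)) (hi j)
    have hvi : μ * v i = ∑ j, A i j * v j := by
      simpa [Matrix.mulVec, dotProduct] using (congrFun hv i).symm
    have hwi : r * w i = ∑ j, A i j * w j := by
      simpa [Matrix.mulVec, dotProduct] using (congrFun h i).symm
    have key : |μ| * |v i| ≤ r * |v i| := calc
      |μ| * |v i| = |∑ j, A i j * v j| := by rw [← abs_mul, hvi]
      _ ≤ ∑ j, |A i j * v j| := Finset.abs_sum_le_sum_abs _ _
      _ ≤ ∑ j, A i j * (t * w j) := by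
        refine Finset.sum_le_sum fun j _ => ?_
        rw [abs_mul, abs_of_nonneg (hA i j)]
        exact mul_le_mul_of_nonneg_left (hle j) (hA i j)
      _ = t * ∑ j, A i j * w j := by
        rw [Finset.mul_sum]
        exact Finset.sum_congr rfl fun j _ => by ring
      _ = r * |v i| := by rw [← hwi, hti]; ring
    have hpos : 0 < |v i| := hti ▸ mul_pos htpos (hw i)
    exact (le_abs_self μ).trans (le_of_mul_le_mul_right key hpos)

lemma signlessLapMatrix_nonneg {V : Type*} [Fintype V] [DecidableEq V] (G : SimpleGraph V)
    (i j : V) : 0 ≤ signlessLapMatrix G i j := by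
  classical
  simp only [signlessLapMatrix, Matrix.add_apply, Matrix.diagonal_apply, adjMatrix_apply]
  positivity

open Classical in
lemma signlessLapMatrix_mulVec {V : Type*} [Fintype V] [DecidableEq V] (G : SimpleGraph V)
    (w : V → ℝ) (i : V) :
    (signlessLapMatrix G).mulVec w i = ∑ j, if G.Adj i j then w i + w j else 0 := by
  rw [signlessLapMatrix, Matrix.add_mulVec, Pi.add_apply, Matrix.mulVec_diagonal,
    adjMatrix_mulVec_apply, ← Finset.sum_filter, Finset.sum_add_distrib, Finset.sum_const,
    ← card_neighborFinset_eq_degree, neighborFinset_eq_filter, nsmul_eq_mul]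

lemma Fgraph_adj_zero {m c : ℕ} (j : Fin (m + 1)) : (Fgraph (m + 1) c).Adj 0 j ↔ j ≠ 0 := by
  simp [Fgraph, eq_comm]

lemma Fgraph_adj_of_ne_zero {m c : ℕ} {i : Fin (m + 1)} (hi : i ≠ 0) (j : Fin (m + 1)) :
    (Fgraph (m + 1) c).Adj i j ↔ j = 0 ∨
      (i.val ≤ 2 * c ∧ j.val = if i.val % 2 = 1 then i.val + 1 else i.val - 1) := by
  have : i.val ≠ 0 := fun h => hi (Fin.ext h)
  simp only [Fgraph, fromRel_adj, ne_eq, Fin.ext_iff, Fin.val_zero]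
  split_ifs <;> omega

lemma card_filter_succ_le {m k : ℕ} (hk : k ≤ m) :
    (#{j : Fin m | j.val + 1 ≤ k}) = k := by
  simpa [Nat.succ_le_iff, hk] using Fin.card_filter_val_lt (n := m) (m := k)

/-- The Perron vector of `F_{m+1,c}` belonging to the eigenvalue `r`. -/
noncomputable def FgraphVec (m c : ℕ) (r : ℝ) (i : Fin (m + 1)) : ℝ :=
  if i.val = 0 then (r - 3) * (r - 1) else if i.val ≤ 2 * c then r - 1 else r - 3

lemma signlessLapMatrix_Fgraph_mulVec {m c : ℕ} (hc : 2 * c ≤ m) {r : ℝ}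
    (hr : r * (r - 3) * (r - (m + 1)) = 4 * c) :
    (signlessLapMatrix (Fgraph (m + 1) c)).mulVec (FgraphVec m c r) = r • FgraphVec m c r := by
  classical
  ext i
  rw [signlessLapMatrix_mulVec, Pi.smul_apply, smul_eq_mul]
  by_cases hi : i = 0
  · subst hi
    simp only [Fgraph_adj_zero, Fin.sum_univ_succ, ne_eq, not_true_eq_false, if_false,
      Fin.succ_ne_zero, not_false_eq_true, if_true, zero_add, Finset.sum_add_distrib,
      Finset.sum_const, Finset.card_univ, Fintype.card_fin, nsmul_eq_mul]
    simp only [FgraphVec, Fin.val_zero, if_true, Fin.val_succ, Nat.succ_ne_zero, if_false]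
    have hcard : ∑ j : Fin m, (if j.val + 1 ≤ 2 * c then r - 1 else r - 3)
        = 2 * c * 2 + m * (r - 3) := by
      have : ∀ j : Fin m, (if j.val + 1 ≤ 2 * c then r - 1 else r - 3)
          = (if j.val + 1 ≤ 2 * c then 2 else 0) + (r - 3) := by
        intro j; split_ifs <;> ring
      rw [Finset.sum_congr rfl fun j _ => this j, Finset.sum_add_distrib, ← Finset.sum_filter,
        Finset.sum_const, Finset.sum_const, card_filter_succ_le hc]
      simp
    rw [hcard]
    linear_combination -hr
  · have hi0 : i.val ≠ 0 := fun h => hi (Fin.ext h)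
    simp only [Fgraph_adj_of_ne_zero hi]
    by_cases hic : i.val ≤ 2 * c
    · set p : Fin (m + 1) :=
        ⟨if i.val % 2 = 1 then i.val + 1 else i.val - 1, by split_ifs <;> omega⟩ with hp
      have hp0 : p.val ≠ 0 := by simp only [hp]; split_ifs <;> omega
      have hpc : p.val ≤ 2 * c := by simp only [hp]; split_ifs <;> omega
      have hsum : ∀ j : Fin (m + 1),
          (if j = 0 ∨ (i.val ≤ 2 * c ∧ j.val = if i.val % 2 = 1 then i.val + 1 else i.val - 1)
            then FgraphVec m c r i + FgraphVec m c r j else 0)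
          = (if j = 0 then FgraphVec m c r i + FgraphVec m c r j else 0)
            + (if j = p then FgraphVec m c r i + FgraphVec m c r j else 0) := by
        intro j
        have hj : (j.val = if i.val % 2 = 1 then i.val + 1 else i.val - 1) ↔ j = p := by
          simp [hp, Fin.ext_iff]
        simp only [hj]
        by_cases h0 : j = 0
        · have : j ≠ p := fun h => hp0 (by rw [← h, h0]; rfl)
          simp [h0, h0 ▸ this]
        · simp [h0, hic]
      rw [Finset.sum_congr rfl fun j _ => hsum j, Finset.sum_add_distrib]
      simp only [Finset.sum_ite_eq', Finset.mem_univ, if_true]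
      simp only [FgraphVec, hi0, hic, hp0, hpc, Fin.val_zero, if_true, if_false]
      ring
    · simp only [hic, false_and, or_false, Finset.sum_ite_eq', Finset.mem_univ, if_true]
      simp only [FgraphVec, hi0, hic, Fin.val_zero, if_true, if_false]
      ring

/-- `q(F_{m+1,c})` is the root larger than `m + 1` of `r (r - 3) (r - (m + 1)) = 4 c`. -/
lemma qSpecRad_Fgraph {m c : ℕ} (hm : 2 ≤ m) (hc1 : 1 ≤ c) (hc : 2 * c ≤ m) :
    (m : ℝ) + 1 < qSpecRad (Fgraph (m + 1) c) ∧
      qSpecRad (Fgraph (m + 1) c) * (qSpecRad (Fgraph (m + 1) c) - 3) *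
        (qSpecRad (Fgraph (m + 1) c) - (m + 1)) = 4 * c := by
  have hm' : (2 : ℝ) ≤ m := by exact_mod_cast hm
  have hc1' : (1 : ℝ) ≤ c := by exact_mod_cast hc1
  have hc' : 2 * (c : ℝ) ≤ m := by exact_mod_cast hc
  obtain ⟨r, ⟨hr1, -⟩, hr⟩ : (4 * c : ℝ) ∈
      (fun r : ℝ => r * (r - 3) * (r - (m + 1))) '' Set.Icc ((m : ℝ) + 1) (m + 3) := by
    refine intermediate_value_Icc (by linarith) (by fun_prop) ⟨?_, ?_⟩
    · simp only [sub_self, mul_zero]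
      positivity
    · nlinarith
  have hr1 : (m : ℝ) + 1 < r := by
    refine lt_of_le_of_ne hr1 fun h => ?_
    simp only [← h, sub_self, mul_zero] at hr
    linarith
  have hq : qSpecRad (Fgraph (m + 1) c) = r := by
    refine sSup_spectrum_eq_of_pos_eigenvector _ (signlessLapMatrix_nonneg _)
      (FgraphVec m c r) (fun i => ?_) r (signlessLapMatrix_Fgraph_mulVec hc hr)
    have h1 : 0 < r - 1 := by linarith
    have h3 : 0 < r - 3 := by linarith
    unfold FgraphVec
    split_ifs <;> positivity
  rw [hq]
  exact ⟨hr1, hr⟩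

lemma qSpecRad_Fgraph_lt {m c d : ℕ} (hm : 2 ≤ m) (hc1 : 1 ≤ c) (hcd : c < d) (hd : 2 * d ≤ m) :
    qSpecRad (Fgraph (m + 1) c) < qSpecRad (Fgraph (m + 1) d) := by
  obtain ⟨h1, e1⟩ := qSpecRad_Fgraph hm hc1 (by omega : 2 * c ≤ m)
  obtain ⟨h2, e2⟩ := qSpecRad_Fgraph hm (by omega : 1 ≤ d) hd
  have hm' : (2 : ℝ) ≤ m := by exact_mod_cast hm
  have hcd' : (c : ℝ) < d := by exact_mod_cast hcd
  generalize qSpecRad (Fgraph (m + 1) c) = x at *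
  generalize qSpecRad (Fgraph (m + 1) d) = y at *
  by_contra! hyx
  have : y * (y - 3) * (y - (m + 1)) ≤ x * (x - 3) * (x - (m + 1)) := by
    have : 0 ≤ y - 3 := by linarith
    have : 0 ≤ y - (m + 1) := by linarith
    have : 0 ≤ x - 3 := by linarith
    have : 0 ≤ x := by linarith
    have : 0 ≤ x * (x - 3) := by positivity
    gcongr
  linarith

theorem stmt2 (n c : ℕ) (hn : 3 ≤ n) (hc1 : 1 ≤ c) (hc2 : c ≤ (n - 1) / 2) :
    (n : ℝ) < qSpecRad (Fgraph n c) ∧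
    qSpecRad (Fgraph n c) ≤ qSpecRad (Fgraph n ((n - 1) / 2)) ∧
    (qSpecRad (Fgraph n c) = qSpecRad (Fgraph n ((n - 1) / 2)) ↔ c = (n - 1) / 2) := by
  obtain ⟨m, rfl⟩ : ∃ m, n = m + 1 := ⟨n - 1, by omega⟩
  have hlt := (qSpecRad_Fgraph (by omega : 2 ≤ m) hc1 (by omega)).1
  refine ⟨by exact_mod_cast hlt, ?_⟩
  rcases hc2.eq_or_lt with h | h
  · rw [← h]
    simp
  · have := qSpecRad_Fgraph_lt (by omega : 2 ≤ m) hc1 h (by omega)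
    exact ⟨this.le, iff_of_false this.ne h.ne⟩
end

section
/- For any simple graph G without isolated vertices, q(G) ≤ max over vertices u of ( d(u) + (1/d(u)) · Σ_{v ∈ N(u)} d(v) ), where d denotes vertex degree and N(u) the neighborhood of u. Moreover, if G is connected, then equality holds if and only if G is regular or G is a semi-regular bipartite graph. -/
open SimpleGraph Finset

/-- The signless Laplacian acts on a vector by `x ↦ d(u) x(u) + ∑_{v ∼ u} x(v)`. -/
lemma signlessLapMatrix_mulVec_apply {V : Type*} [Fintype V] [DecidableEq V]
    (G : SimpleGraph V) [DecidableRel G.Adj] (x : V → ℝ) (u : V) :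
    (signlessLapMatrix G).mulVec x u = G.degree u * x u + ∑ v ∈ G.neighborFinset u, x v := by
  rw [signlessLapMatrix, Matrix.add_mulVec, Pi.add_apply, Matrix.mulVec_diagonal,
    SimpleGraph.adjMatrix_mulVec_apply]
  congr!

/-- Membership in the spectrum of a real matrix amounts to having an eigenvector. -/
lemma Matrix.mem_spectrum_iff_exists_mulVec_eq {V : Type*} [Fintype V] [DecidableEq V]
    (A : Matrix V V ℝ) (t : ℝ) :
    t ∈ spectrum ℝ A ↔ ∃ x : V → ℝ, x ≠ 0 ∧ A.mulVec x = t • x := by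
  rw [← Matrix.spectrum_toLin', ← Module.End.hasEigenvalue_iff_mem_spectrum]
  constructor
  · intro h
    obtain ⟨x, hx⟩ := h.exists_hasEigenvector
    exact ⟨x, hx.2, by simpa using hx.apply_eq_smul⟩
  · rintro ⟨x, hx, h⟩
    exact Module.End.hasEigenvalue_of_hasEigenvector
      (Module.End.hasEigenvector_iff.2 ⟨Module.End.mem_eigenspace_iff.2 (by simpa using h), hx⟩)

lemma signlessLapMatrix_isHermitian {V : Type*} [Fintype V] [DecidableEq V]
    (G : SimpleGraph V) : (signlessLapMatrix G).IsHermitian := by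
  classical
  refine (Matrix.isHermitian_diagonal _).add ?_
  ext i j
  simp [SimpleGraph.adjMatrix_apply, G.adj_comm]

lemma qSpecRad_mem_spectrum {V : Type*} [Fintype V] [DecidableEq V] [Nonempty V]
    (G : SimpleGraph V) : qSpecRad G ∈ spectrum ℝ (signlessLapMatrix G) :=
  Set.Nonempty.csSup_mem
    ⟨_, (signlessLapMatrix_isHermitian G).eigenvalues_mem_spectrum_real (Classical.arbitrary V)⟩
    Matrix.finite_real_spectrum

lemma le_qSpecRad_of_mem_spectrum {V : Type*} [Fintype V] [DecidableEq V]
    {G : SimpleGraph V} {t : ℝ} (ht : t ∈ spectrum ℝ (signlessLapMatrix G)) : t ≤ qSpecRad G :=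
  le_csSup Matrix.finite_real_spectrum.bddAbove ht

section

variable {V : Type*} [Fintype V] {G : SimpleGraph V} [DecidableRel G.Adj]

/-- Every eigenvalue has an eigenvector of the form `v ↦ d(v) y(v)` where `y` attains its maximal
absolute value at a point where it is positive. -/
lemma exists_scaled_eigenvector [DecidableEq V] [Nonempty V]
    (hiso : ∀ v, 0 < G.degree v) {t : ℝ}
    (ht : t ∈ spectrum ℝ (signlessLapMatrix G)) :
    ∃ (y : V → ℝ) (w : V), 0 < y w ∧ (∀ v, y v ≤ y w) ∧
      ∀ u, t * (G.degree u * y u) =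
        G.degree u * (G.degree u * y u) + ∑ v ∈ G.neighborFinset u, G.degree v * y v := by
  obtain ⟨x, hx, hxt⟩ := (Matrix.mem_spectrum_iff_exists_mulVec_eq _ _).1 ht
  have hd (v : V) : (G.degree v : ℝ) ≠ 0 := by exact_mod_cast (hiso v).ne'
  have hx' (u : V) : t * x u = G.degree u * x u + ∑ v ∈ G.neighborFinset u, x v := by
    rw [← signlessLapMatrix_mulVec_apply, hxt, Pi.smul_apply, smul_eq_mul]
  obtain ⟨w, hw⟩ := Finite.exists_max fun v => |x v / G.degree v|
  have hw0 : x w / G.degree w ≠ 0 := by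
    intro h0
    refine hx (funext fun v => ?_)
    have := hw v
    simp only [h0, abs_zero] at this
    simpa [hd v] using abs_nonpos_iff.1 this
  rcases lt_or_gt_of_ne hw0 with hneg | hpos
  · refine ⟨fun v => -(x v / G.degree v), w, by linarith, fun v => ?_, fun u => ?_⟩
    · exact (neg_le_abs _).trans ((hw v).trans_eq (abs_of_neg hneg))
    · simp only [mul_neg, mul_div_cancel₀ _ (hd _), Finset.sum_neg_distrib, hx' u]
      ring
  · refine ⟨fun v => x v / G.degree v, w, hpos, fun v => ?_, fun u => ?_⟩
    · exact (le_abs_self _).trans ((hw v).trans_eq (abs_of_pos hpos))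
    · simp only [mul_div_cancel₀ _ (hd _), hx' u]

lemma degree_mul_degree_add_avg (hiso : ∀ v, 0 < G.degree v) (u : V) :
    (G.degree u : ℝ) * ((G.degree u : ℝ) +
      (1 / (G.degree u : ℝ)) * ∑ v ∈ G.neighborFinset u, (G.degree v : ℝ)) =
    G.degree u * G.degree u + ∑ v ∈ G.neighborFinset u, (G.degree v : ℝ) := by
  have hd : (G.degree u : ℝ) ≠ 0 := by exact_mod_cast (hiso u).ne'
  field_simp

lemma qSpecRad_le_of_forall_sum_degree_le [DecidableEq V] [Nonempty V]
    (hiso : ∀ v, 0 < G.degree v) {M : ℝ}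
    (hM : ∀ u, (G.degree u : ℝ) * G.degree u + ∑ v ∈ G.neighborFinset u, (G.degree v : ℝ)
      ≤ M * G.degree u) :
    qSpecRad G ≤ M := by
  obtain ⟨y, w, hpos, hmax, heq⟩ := exists_scaled_eigenvector hiso (qSpecRad_mem_spectrum G)
  have hd : (0 : ℝ) < G.degree w := by exact_mod_cast hiso w
  have hsum : ∑ v ∈ G.neighborFinset w, G.degree v * y v ≤
      (∑ v ∈ G.neighborFinset w, (G.degree v : ℝ)) * y w := by
    rw [Finset.sum_mul]
    gcongr with v
    exact hmax v
  refine le_of_mul_le_mul_right ?_ (mul_pos hd hpos)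
  have := mul_le_mul_of_nonneg_right (hM w) hpos.le
  linarith [heq w]

lemma sum_degree_eq_of_qSpecRad_eq [DecidableEq V] [Nonempty V]
    (hiso : ∀ v, 0 < G.degree v) (hG : G.Connected) {M : ℝ}
    (hM : ∀ u, (G.degree u : ℝ) * G.degree u + ∑ v ∈ G.neighborFinset u, (G.degree v : ℝ)
      ≤ M * G.degree u) (hq : qSpecRad G = M) (u : V) :
    (G.degree u : ℝ) * G.degree u + ∑ v ∈ G.neighborFinset u, (G.degree v : ℝ)
      = M * G.degree u := by
  obtain ⟨y, w, hpos, hmax, heq⟩ := exists_scaled_eigenvector hiso (qSpecRad_mem_spectrum G)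
  rw [hq] at heq
  have hle (a : V) : ∀ v ∈ G.neighborFinset a, G.degree v * y v ≤ G.degree v * y w :=
    fun v _ => mul_le_mul_of_nonneg_left (hmax v) (Nat.cast_nonneg _)
  have hstep {a b : V} (hab : G.Adj a b) (ha : y a = y w) : y b = y w := by
    have hsum : ∑ v ∈ G.neighborFinset a, G.degree v * y v =
        ∑ v ∈ G.neighborFinset a, G.degree v * y w := by
      refine (Finset.sum_le_sum (hle a)).antisymm ?_
      rw [← Finset.sum_mul]
      have := mul_le_mul_of_nonneg_right (hM a) hpos.le
      have := heq a
      rw [ha] at this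
      linarith
    have hb := (Finset.sum_eq_sum_iff_of_le (hle a)).1 hsum b (by simpa using hab)
    exact mul_left_cancel₀ (by exact_mod_cast (hiso b).ne') hb
  have hconst (a : V) : y a = y w := by
    obtain ⟨p⟩ := hG.preconnected a w
    induction p with
    | nil => rfl
    | cons h _ ih => exact hstep h.symm (ih hpos hmax hle hstep)
  have h := heq u
  simp only [hconst, ← Finset.sum_mul] at h
  refine mul_right_cancel₀ hpos.ne' ?_
  linarith

lemma le_qSpecRad_of_forall_sum_degree_eq [DecidableEq V] [Nonempty V]
    (hiso : ∀ v, 0 < G.degree v) {M : ℝ}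
    (hM : ∀ u, (G.degree u : ℝ) * G.degree u + ∑ v ∈ G.neighborFinset u, (G.degree v : ℝ)
      = M * G.degree u) : M ≤ qSpecRad G := by
  refine le_qSpecRad_of_mem_spectrum
    ((Matrix.mem_spectrum_iff_exists_mulVec_eq _ _).2 ⟨fun v => G.degree v, fun h => ?_, ?_⟩)
  · have h0 := congrFun h (Classical.arbitrary V)
    have := (hiso (Classical.arbitrary V)).ne'
    simp_all
  · ext u
    rw [signlessLapMatrix_mulVec_apply, hM u]
    rfl

/-- If `d(u)` plus the average degree of the neighbors of `u` is constant, then `G` is regular or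
semi-regular bipartite. -/
lemma regular_or_semiregular_of_forall_sum_degree_eq [Nonempty V]
    (hiso : ∀ v, 0 < G.degree v) (hG : G.Connected) {M : ℝ}
    (hM : ∀ u, (G.degree u : ℝ) * G.degree u + ∑ v ∈ G.neighborFinset u, (G.degree v : ℝ)
      = M * G.degree u) : IsRegularGraph G ∨ IsSemiregularBipartite G := by
  have hd (v : V) : (0 : ℝ) < G.degree v := by exact_mod_cast hiso v
  obtain ⟨a, ha⟩ := Finite.exists_max fun v => (G.degree v : ℝ)
  obtain ⟨b, hb⟩ := Finite.exists_min fun v => (G.degree v : ℝ)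
  have hcard (u : V) (c : ℝ) : ∑ _v ∈ G.neighborFinset u, c = G.degree u * c := by simp
  have h1 : (G.degree a : ℝ) + G.degree b ≤ M := by
    refine le_of_mul_le_mul_right ?_ (hd a)
    have := Finset.sum_le_sum fun v (_ : v ∈ G.neighborFinset a) => hb v
    rw [hcard] at this
    linarith [hM a]
  have h2 : M ≤ G.degree a + G.degree b := by
    refine le_of_mul_le_mul_right ?_ (hd b)
    have := Finset.sum_le_sum fun v (_ : v ∈ G.neighborFinset b) => ha v
    rw [hcard] at this
    linarith [hM b]
  have hMeq : M = G.degree a + G.degree b := le_antisymm h2 h1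
  have hmax {u v : V} (huv : G.Adj u v) (hu : G.degree u = G.degree a) :
      G.degree v = G.degree b := by
    have hsum : ∑ _v ∈ G.neighborFinset u, (G.degree b : ℝ) =
        ∑ v ∈ G.neighborFinset u, (G.degree v : ℝ) := by
      have := hM u
      rw [hcard]
      rw [hMeq, hu] at *
      linarith
    have := (Finset.sum_eq_sum_iff_of_le fun v _ => hb v).1 hsum v (by simpa using huv)
    exact_mod_cast this.symm
  have hmin {u v : V} (huv : G.Adj u v) (hu : G.degree u = G.degree b) :
      G.degree v = G.degree a := by
    have hsum : ∑ v ∈ G.neighborFinset u, (G.degree v : ℝ) =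
        ∑ _v ∈ G.neighborFinset u, (G.degree a : ℝ) := by
      have := hM u
      rw [hcard]
      rw [hMeq, hu] at *
      linarith
    have := (Finset.sum_eq_sum_iff_of_le fun v _ => ha v).1 hsum v (by simpa using huv)
    exact_mod_cast this
  have hall (u : V) : G.degree u = G.degree a ∨ G.degree u = G.degree b := by
    obtain ⟨p⟩ := hG.preconnected u a
    clear h1 h2 hMeq
    induction p with
    | nil => exact Or.inl rfl
    | cons h _ ih => exact (ih ha hmax hmin).elim (Or.inr ∘ hmax h.symm) (Or.inl ∘ hmin h.symm)
  by_cases hab : G.degree a = G.degree b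
  · refine Or.inl ⟨G.degree a, fun v => ?_⟩
    have := hall v
    rw [← hab, or_self] at this
    convert this
  · refine Or.inr ⟨{v | G.degree v = G.degree a}, G.degree a, G.degree b, ?_, ?_, ?_⟩
    · intro u v huv
      simp only [Set.mem_ofPred_eq]
      refine ⟨fun hu hv => hab (hv.symm.trans (hmax huv hu)), fun hv => ?_⟩
      exact hmin huv.symm ((hall v).resolve_left hv)
    · intro v hv
      have hva : G.degree v = G.degree a := hv
      convert hva
    · intro v hv
      convert (hall v).resolve_left hv

lemma exists_sum_degree_eq_of_regular_or_semiregular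
    (h : IsRegularGraph G ∨ IsSemiregularBipartite G) :
    ∃ M : ℝ, ∀ u, (G.degree u : ℝ) * G.degree u +
      ∑ v ∈ G.neighborFinset u, (G.degree v : ℝ) = M * G.degree u := by
  rcases h with ⟨d, h⟩ | ⟨s, d₁, d₂, hs, h₁, h₂⟩
  · have h' (v : V) : G.degree v = d := by convert h v
    refine ⟨d + d, fun u => ?_⟩
    simp only [h', Finset.sum_const, card_neighborFinset_eq_degree, nsmul_eq_mul]
    ring
  · have h₁' (v : V) (hv : v ∈ s) : G.degree v = d₁ := by convert h₁ v hv
    have h₂' (v : V) (hv : v ∉ s) : G.degree v = d₂ := by convert h₂ v hv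
    refine ⟨d₁ + d₂, fun u => ?_⟩
    by_cases hu : u ∈ s
    · have hsum : ∑ v ∈ G.neighborFinset u, (G.degree v : ℝ) =
          ∑ _v ∈ G.neighborFinset u, (d₂ : ℝ) :=
        Finset.sum_congr rfl fun v hv => by
          rw [h₂' v ((hs ((G.mem_neighborFinset u v).1 hv)).1 hu)]
      rw [hsum, Finset.sum_const, card_neighborFinset_eq_degree, nsmul_eq_mul, h₁' u hu]
      ring
    · have hsum : ∑ v ∈ G.neighborFinset u, (G.degree v : ℝ) =
          ∑ _v ∈ G.neighborFinset u, (d₁ : ℝ) :=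
        Finset.sum_congr rfl fun v hv => by
          rw [h₁' v ((hs ((G.mem_neighborFinset u v).1 hv).symm).2 hu)]
      rw [hsum, Finset.sum_const, card_neighborFinset_eq_degree, nsmul_eq_mul, h₂' u hu]
      ring

end

theorem stmt7 {V : Type*} [Fintype V] [DecidableEq V] [Nonempty V]
    (G : SimpleGraph V) [DecidableRel G.Adj] (hiso : ∀ v, 0 < G.degree v) :
    qSpecRad G ≤ Finset.univ.sup' Finset.univ_nonempty
      (fun u => (G.degree u : ℝ) +
        (1 / (G.degree u : ℝ)) * ∑ v ∈ G.neighborFinset u, (G.degree v : ℝ)) ∧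
    (G.Connected →
      (qSpecRad G = Finset.univ.sup' Finset.univ_nonempty
          (fun u => (G.degree u : ℝ) +
            (1 / (G.degree u : ℝ)) * ∑ v ∈ G.neighborFinset u, (G.degree v : ℝ)) ↔
        IsRegularGraph G ∨ IsSemiregularBipartite G)) := by
  set M := Finset.univ.sup' Finset.univ_nonempty
    (fun u => (G.degree u : ℝ) +
      (1 / (G.degree u : ℝ)) * ∑ v ∈ G.neighborFinset u, (G.degree v : ℝ)) with hMdef
  have hM (u : V) : (G.degree u : ℝ) * G.degree u + ∑ v ∈ G.neighborFinset u, (G.degree v : ℝ)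
      ≤ M * G.degree u := by
    rw [← degree_mul_degree_add_avg hiso u, mul_comm M]
    exact mul_le_mul_of_nonneg_left (Finset.le_sup' (fun u => (G.degree u : ℝ) +
      (1 / (G.degree u : ℝ)) * ∑ v ∈ G.neighborFinset u, (G.degree v : ℝ)) (Finset.mem_univ u))
      (Nat.cast_nonneg _)
  have hle := qSpecRad_le_of_forall_sum_degree_le hiso hM
  refine ⟨hle, fun hG => ⟨fun hq => ?_, fun h => hle.antisymm ?_⟩⟩
  · exact regular_or_semiregular_of_forall_sum_degree_eq hiso hG
      (sum_degree_eq_of_qSpecRad_eq hiso hG hM hq)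
  · obtain ⟨c, hc⟩ := exists_sum_degree_eq_of_regular_or_semiregular h
    refine le_trans (Finset.sup'_le _ _ fun u _ => ?_) (le_qSpecRad_of_forall_sum_degree_eq hiso hc)
    refine le_of_mul_le_mul_left ?_ (Nat.cast_pos.2 (hiso u))
    rw [degree_mul_degree_add_avg hiso u, hc u, mul_comm]
end
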